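/- For any L > 0 and any C² function u : [0,L] → ℝ satisfying u'(0) = u'(L) = 0 and ∫₀ᴸ u(s) ds = 0, one has ∫₀ᴸ u(s)⁴ ds ≤ 0.162278 · L · (∫₀ᴸ u(s)² ds) · (∫₀ᴸ u'(s)² ds). -/

import Mathlib

namespace IQ

def ladd {α : Type} (f : α → α → α) : List α → List α → List α
  | [], q => q
  | a :: p, [] => a :: p
  | a :: p, b :: q => f a b :: ladd f p q

def lmul {α : Type} (f g : α → α → α) (z : α) : List α → List α → List α
  | [], _ => []
  | a :: p, q => ladd f (q.map (g a)) (z :: lmul f g z p q)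

abbrev P1 := List ℤ
abbrev P2 := List P1
abbrev P3 := List P2

def add1 : P1 → P1 → P1 := ladd Int.add
def mul1 : P1 → P1 → P1 := lmul Int.add Int.mul 0
def add2 : P2 → P2 → P2 := ladd add1
def mul2 : P2 → P2 → P2 := lmul add1 mul1 []
def add3 : P3 → P3 → P3 := ladd add2
def mul3 : P3 → P3 → P3 := lmul add2 mul2 []
def sc1 (c : ℤ) (l : P1) : P1 := l.map (Int.mul c)
def sc2 (c : ℤ) (l : P2) : P2 := l.map (sc1 c)

/-- moments of the semicircle weight, as coefficients -/
def qadd2 : List (List ℚ) → List (List ℚ) → List (List ℚ) := ladd (ladd (fun x y => x + y))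
def wsc (w : ℚ) (c : P2) : List (List ℚ) := c.map (fun l : P1 => l.map (fun x : ℤ => w * (x : ℚ)))
def mom : ℕ → ℚ → P3 → List (List ℚ)
  | _, _, [] => []
  | _, w, [c] => wsc w c
  | k, w, c :: _ :: l => qadd2 (wsc w c) (mom (k+1) (w * ((2*k+1)/(2*k+4))) l)

def cst (y : P1) : P3 := y.map (fun c => [[c]])
def rP : P3 := [[[0,1],[],[4]], [[],[4]], [[1]]]

def GI (y : P1) : P3 :=
  let y2 := mul1 y y
  let y3 := mul1 y y2
  let y5 := mul1 y3 y2
  let y7 := mul1 y5 y2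
  let r2 := mul3 rP rP
  let r3 := mul3 r2 rP
  let r4 := mul3 r3 rP
  add3 (mul3 (cst (sc1 (35 * 64^6) y)) rP)
   (add3 (mul3 (cst (sc1 (-35 * 64^4) y3)) r2)
   (add3 (mul3 (cst (sc1 (21 * 64^2) y5)) r3)
    (mul3 (cst (sc1 (-5) y7)) r4)))

/-- floor of 2^40 * G -/
def GZ (y : P1) : P2 := (mom 0 (1/16) (GI y)).map (fun l => l.map (fun x => Int.ediv (x.num * 2^40) (x.den * 64^7)))

/-- rescaling: coefficient of a^i s^j becomes floor (c * S / (da^i * ds^j * D)) -/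
def dS (ds S : ℕ) : ℕ → P1 → P1
  | _, [] => []
  | D, c :: l => Int.ediv (Int.mul c (Int.ofNat S)) (Int.ofNat D) :: dS ds S (D * ds) l
def dA (da ds S : ℕ) : ℕ → P2 → P2
  | _, [] => []
  | D, c :: l => dS ds S D c :: dA da ds S (D * da) l

/-- shift x = x0 + t -/
def sh1 (x0 : ℤ) : P1 → P1
  | [] => []
  | c :: l => let q := sh1 x0 l; add1 (c :: q) (sc1 x0 q)
def sh2 (x0 : ℤ) : P2 → P2
  | [] => []
  | c :: l => let q := sh2 x0 l; add2 (c :: q) (sc2 x0 q)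

def mn (w : ℕ) : ℤ → ℤ
  | Int.ofNat _ => 0
  | Int.negSucc n => Int.mul (Int.ofNat w) (Int.negSucc n)
def low1 (w : ℕ) : P1 → ℤ
  | [] => 0
  | c :: l => Int.add c (mn w (low1 w l))
def low2 (wa ws : ℕ) : P2 → ℤ
  | [] => 0
  | c :: l => Int.add (low1 ws c) (mn wa (low2 wa ws l))
def nn : ℤ → Bool
  | Int.ofNat _ => true
  | Int.negSucc _ => false

/-- check nonnegativity on [0,wa]x[0,ws] -/
def chk : ℕ → ℕ → ℕ → ℕ → P2 → Bool
  | 0, _, _, _, _ => false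
  | n+1, d, wa, ws, M => bif nn (low2 wa ws M) then true else
     bif Nat.beq d 3 then chk n 0 (wa/2) ws M && chk n 0 (wa-wa/2) ws (sh2 (Int.ofNat (wa/2)) M)
     else chk n (d+1) wa (ws/2) M && chk n (d+1) wa (ws-ws/2) (M.map (sh1 (Int.ofNat (ws/2))))

def SC : ℕ := 2^300
def DA : ℕ := 2^10
def DS : ℕ := 2^16
/-- check nonnegativity for a in [a0, a0+wa]/64, s in [s0,s0+ws]/64 -/
def box (a0 wa s0 ws : ℕ) (M : P2) : Bool :=
  chk 20 0 (wa * 2^4) (ws * 2^10) (sh2 (Int.ofNat (a0 * 2^4)) ((dA DA DS SC 1 M).map (sh1 (Int.ofNat (s0 * 2^10)))))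

def kN : ℕ := 162278 * 314159265^2
def kD : ℕ := 10^22 * 4
def Rm : P2 := mul2 (mul2 [[1,-1],[],[2]] [[1],[],[-1]]) [[0,1],[],[1]]
def KP (G : P2) : P2 :=
  add2 (sc2 (Int.ofNat kN) (mul2 G G)) (sc2 (Int.negOfNat (kD * 2^80)) Rm)
def SP : P2 := add2 [[0, Int.ofNat kN],[],[Int.ofNat (4*kN)]] (sc2 (Int.negOfNat kD) Rm)
/-- nonnegativity on [-1,1]: y(-1+t), t in [0,2] -/
def pos1 (y : P1) : Bool := chk 20 0 1 (2*2^10) [dS (2^10) (2^100) 1 (sh1 (-1) y)]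

def full (y : P1) (a0 wa : ℕ) : Bool :=
  let G := GZ y
  pos1 y && (box a0 wa 0 39 G && box a0 wa 0 39 (KP G))

def yA : P1 := [117,0,-168,0,197,0,-91]
def yB : P1 := [102,-58,-76,94,34,-46,-4]
def yC : P1 := [82,-64,-14,70,-8,-26]
def yD : P1 := [64,-40,8]

/-! ### soundness -/

noncomputable def lev {α : Type} (e : α → ℝ) (x : ℝ) : List α → ℝ
  | [] => 0
  | c :: l => e c + x * lev e x l

theorem lev_ladd {α : Type} (e : α → ℝ) (x : ℝ) (f : α → α → α)
    (hf : ∀ a b, e (f a b) = e a + e b) (p q : List α) :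
    lev e x (ladd f p q) = lev e x p + lev e x q := by
  induction p generalizing q with
  | nil => simp [ladd, lev]
  | cons a p ih =>
    cases q with
    | nil => simp [ladd, lev]
    | cons b q => simp only [ladd, lev, ih, hf]; ring

theorem lev_map {α β : Type} (e : α → ℝ) (e' : β → ℝ) (x : ℝ) (g : β → α) (k : ℝ)
    (hg : ∀ b, e (g b) = k * e' b) (q : List β) :
    lev e x (q.map g) = k * lev e' x q := by
  induction q with
  | nil => simp [lev]
  | cons b q ih => simp only [List.map, lev, ih, hg]; ring

theorem lev_lmul {α : Type} (e : α → ℝ) (x : ℝ) (f g : α → α → α) (z : α)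
    (hf : ∀ a b, e (f a b) = e a + e b) (hg : ∀ a b, e (g a b) = e a * e b) (hz : e z = 0)
    (p q : List α) :
    lev e x (lmul f g z p q) = lev e x p * lev e x q := by
  induction p with
  | nil => simp [lmul, lev]
  | cons a p ih =>
    simp only [lmul, lev_ladd e x f hf, lev_map e e x (g a) (e a) (hg a), lev, ih, hz]; ring

noncomputable def ez (c : ℤ) : ℝ := (c : ℝ)
noncomputable def ev1 (s : ℝ) : P1 → ℝ := lev ez s
noncomputable def ev2 (a s : ℝ) : P2 → ℝ := lev (ev1 s) a
noncomputable def ev3 (a s v : ℝ) : P3 → ℝ := lev (ev2 a s) v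

theorem ez_add (a b : ℤ) : ez (Int.add a b) = ez a + ez b := by
  simp only [ez]; exact Int.cast_add a b
theorem ez_mul (a b : ℤ) : ez (Int.mul a b) = ez a * ez b := by
  simp only [ez]; exact Int.cast_mul a b
theorem ev1_add (s : ℝ) (p q : P1) : ev1 s (add1 p q) = ev1 s p + ev1 s q :=
  lev_ladd _ _ _ ez_add p q
theorem ev1_mul (s : ℝ) (p q : P1) : ev1 s (mul1 p q) = ev1 s p * ev1 s q :=
  lev_lmul _ _ _ _ _ ez_add ez_mul (by simp [ez]) p q
theorem ev2_add (a s : ℝ) (p q : P2) : ev2 a s (add2 p q) = ev2 a s p + ev2 a s q :=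
  lev_ladd _ _ _ (ev1_add s) p q
theorem ev2_mul (a s : ℝ) (p q : P2) : ev2 a s (mul2 p q) = ev2 a s p * ev2 a s q :=
  lev_lmul _ _ _ _ _ (ev1_add s) (ev1_mul s) (by simp [ev1, lev]) p q
theorem ev3_add (a s v : ℝ) (p q : P3) : ev3 a s v (add3 p q) = ev3 a s v p + ev3 a s v q :=
  lev_ladd _ _ _ (ev2_add a s) p q
theorem ev3_mul (a s v : ℝ) (p q : P3) : ev3 a s v (mul3 p q) = ev3 a s v p * ev3 a s v q :=
  lev_lmul _ _ _ _ _ (ev2_add a s) (ev2_mul a s) (by simp [ev2, lev]) p q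
theorem ev1_sc (s : ℝ) (c : ℤ) (p : P1) : ev1 s (sc1 c p) = c * ev1 s p :=
  lev_map _ _ _ _ _ (fun b => ez_mul c b) p
theorem ev2_sc (a s : ℝ) (c : ℤ) (p : P2) : ev2 a s (sc2 c p) = c * ev2 a s p :=
  lev_map _ _ _ _ _ (fun b => ev1_sc s c b) p
theorem ev3_cst (a s v : ℝ) (y : P1) : ev3 a s v (cst y) = ev1 v y := by
  have := lev_map (ev2 a s) ez v (fun c => [[c]]) 1 (fun b => by simp [ev2, ev1, lev]) y
  simpa [ev3, cst, ev1] using this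
theorem ev3_rP (a s v : ℝ) : ev3 a s v rP = (v + 2 * a)^2 + s := by
  simp [ev3, ev2, ev1, lev, rP, ez]; ring

theorem ev3_GI (a s v : ℝ) (y : P1) : ev3 a s v (GI y) =
    (64:ℝ)^7 * 16 * (((v + 2 * a)^2 + s) * (ev1 v y / 64) *
      (1 - (((v + 2 * a)^2 + s) * (ev1 v y / 64)^2 - 1) / 2
         + 3 * (((v + 2 * a)^2 + s) * (ev1 v y / 64)^2 - 1)^2 / 8
         - 5 * (((v + 2 * a)^2 + s) * (ev1 v y / 64)^2 - 1)^3 / 16)) := by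
  simp only [GI, ev3_add, ev3_mul, ev3_cst, ev3_rP, ev1_sc, ev1_mul]
  push_cast
  ring

theorem ev1_sh (x0 : ℤ) (t : ℝ) (l : P1) : ev1 t (sh1 x0 l) = ev1 (x0 + t) l := by
  induction l with
  | nil => simp [sh1, ev1, lev]
  | cons c l ih =>
    simp only [sh1, ev1_add, ev1_sc, ih]
    have h1 : ∀ p : P1, ev1 t (c :: p) = ez c + t * ev1 t p := fun p => rfl
    have h2 : ev1 (x0 + t) (c :: l) = ez c + (x0 + t) * ev1 (x0 + t) l := rfl
    rw [h1, h2, ih]; ring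
theorem ev2_sh (x0 : ℤ) (t s : ℝ) (l : P2) : ev2 t s (sh2 x0 l) = ev2 (x0 + t) s l := by
  induction l with
  | nil => simp [sh2, ev2, lev]
  | cons c l ih =>
    simp only [sh2, ev2_add, ev2_sc, ih]
    have h1 : ∀ p : P2, ev2 t s (c :: p) = ev1 s c + t * ev2 t s p := fun p => rfl
    have h2 : ev2 (x0 + t) s (c :: l) = ev1 s c + (x0 + t) * ev2 (x0 + t) s l := rfl
    rw [h1, h2, ih]; ring
theorem ev2_sh1 (x0 : ℤ) (a t : ℝ) (l : P2) :
    ev2 a t (l.map (sh1 x0)) = ev2 a (x0 + t) l := by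
  have := lev_map (ev1 t) (ev1 (x0 + t)) a (sh1 x0) 1 (fun b => by rw [ev1_sh]; ring) l
  simpa [ev2] using this

theorem mn_le (w : ℕ) (t z : ℝ) (k : ℤ) (ht : 0 ≤ t) (htw : t ≤ w) (hk : (k:ℝ) ≤ z) :
    ((mn w k : ℤ) : ℝ) ≤ t * z := by
  cases k with
  | ofNat n =>
    simp only [mn]
    have : (0:ℝ) ≤ z := le_trans (by simp) hk
    simpa using mul_nonneg ht this
  | negSucc n =>
    have e : mn w (Int.negSucc n) = (w:ℤ) * Int.negSucc n := rfl
    rw [e, Int.cast_mul]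
    have h0 : ((Int.negSucc n : ℤ):ℝ) ≤ 0 := by exact_mod_cast (Int.negSucc_lt_zero n).le
    have h1 : t * ((Int.negSucc n : ℤ):ℝ) ≤ t * z := mul_le_mul_of_nonneg_left hk ht
    have h2 : (w:ℝ) * ((Int.negSucc n : ℤ):ℝ) ≤ t * ((Int.negSucc n : ℤ):ℝ) :=
      mul_le_mul_of_nonpos_right htw h0
    push_cast at *
    linarith

theorem low1_le (w : ℕ) (t : ℝ) (ht : 0 ≤ t) (htw : t ≤ w) (l : P1) :
    ((low1 w l : ℤ):ℝ) ≤ ev1 t l := by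
  induction l with
  | nil => simp [low1, ev1, lev]
  | cons c l ih =>
    have h := mn_le w t _ _ ht htw ih
    have e : ((low1 w (c :: l) : ℤ):ℝ) = c + (mn w (low1 w l) : ℤ) := by
      simp only [low1]; exact Int.cast_add _ _
    have e2 : ev1 t (c :: l) = ez c + t * ev1 t l := rfl
    rw [e, e2, ez]; linarith

theorem low2_le (wa ws : ℕ) (a s : ℝ) (ha : 0 ≤ a) (haw : a ≤ wa) (hs : 0 ≤ s) (hsw : s ≤ ws)
    (l : P2) : ((low2 wa ws l : ℤ):ℝ) ≤ ev2 a s l := by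
  induction l with
  | nil => simp [low2, ev2, lev]
  | cons c l ih =>
    have h := mn_le wa a _ _ ha haw ih
    have h1 := low1_le ws s hs hsw c
    have e : ((low2 wa ws (c :: l) : ℤ):ℝ) = (low1 ws c : ℤ) + (mn wa (low2 wa ws l) : ℤ) := by
      simp only [low2]; exact Int.cast_add _ _
    have e2 : ev2 a s (c :: l) = ev1 s c + a * ev2 a s l := rfl
    rw [e, e2]; linarith

theorem nn_sound (k : ℤ) (h : nn k = true) : 0 ≤ k := by
  cases k with
  | ofNat n => exact Int.natCast_nonneg n
  | negSucc n => simp [nn] at h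

theorem chk_sound (n : ℕ) : ∀ (d wa ws : ℕ) (M : P2), chk n d wa ws M = true →
    ∀ a s : ℝ, 0 ≤ a → a ≤ wa → 0 ≤ s → s ≤ ws → 0 ≤ ev2 a s M := by
  induction n with
  | zero => intro d wa ws M h; simp [chk] at h
  | succ n ih =>
    intro d wa ws M h a s ha haw hs hsw
    simp only [chk] at h
    cases h1 : nn (low2 wa ws M) with
    | true =>
      have := nn_sound _ h1
      have h2 := low2_le wa ws a s ha haw hs hsw M
      have : (0:ℝ) ≤ ((low2 wa ws M : ℤ):ℝ) := by exact_mod_cast this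
      linarith
    | false =>
      rw [h1] at h
      simp only [cond_false] at h
      cases h2 : Nat.beq d 3 with
      | true =>
        rw [h2] at h
        simp only [cond_true, Bool.and_eq_true] at h
        rcases le_total a ((wa/2 : ℕ):ℝ) with h3 | h3
        · exact ih _ _ _ _ h.1 a s ha h3 hs hsw
        · have := ih _ _ _ _ h.2 (a - ((wa/2 : ℕ):ℝ)) s (by linarith)
            (by rw [Nat.cast_sub (Nat.div_le_self _ _)]; linarith) hs hsw
          have e : ((Int.ofNat (wa/2) : ℤ):ℝ) + (a - ((wa/2 : ℕ):ℝ)) = a := by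
            rw [Int.ofNat_eq_natCast, Int.cast_natCast]; ring
          rwa [ev2_sh, e] at this
      | false =>
        rw [h2] at h
        simp only [cond_false, Bool.and_eq_true] at h
        rcases le_total s ((ws/2 : ℕ):ℝ) with h3 | h3
        · exact ih _ _ _ _ h.1 a s ha haw hs h3
        · have := ih _ _ _ _ h.2 a (s - ((ws/2 : ℕ):ℝ)) ha haw (by linarith)
            (by rw [Nat.cast_sub (Nat.div_le_self _ _)]; linarith)
          have e : ((Int.ofNat (ws/2) : ℤ):ℝ) + (s - ((ws/2 : ℕ):ℝ)) = s := by
            rw [Int.ofNat_eq_natCast, Int.cast_natCast]; ring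
          rwa [ev2_sh1, e] at this

theorem ediv_le (x : ℤ) (D : ℕ) (hD : 0 < D) : ((Int.ediv x (Int.ofNat D) : ℤ):ℝ) ≤ x / D := by
  rw [le_div_iff₀ (by exact_mod_cast hD)]
  have h : (x / (D:ℤ)) * (D:ℤ) ≤ x := Int.ediv_mul_le x (by exact_mod_cast hD.ne')
  exact_mod_cast h

theorem dS_le (ds S : ℕ) (hds : 0 < ds) (l : P1) : ∀ (D : ℕ), 0 < D → ∀ t : ℝ, 0 ≤ t →
    ev1 t (dS ds S D l) ≤ S / D * ev1 (t / ds) l := by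
  induction l with
  | nil => intro D hD t ht; simp [dS, ev1, lev]
  | cons c l ih =>
    intro D hD t ht
    have h1 := ih (D * ds) (Nat.mul_pos hD hds) t ht
    have e1 : ev1 t (dS ds S D (c :: l)) =
      ((Int.ediv (Int.mul c (Int.ofNat S)) (Int.ofNat D) : ℤ):ℝ) + t * ev1 t (dS ds S (D*ds) l) := rfl
    have e2 : ev1 (t/ds) (c :: l) = (c:ℝ) + t/ds * ev1 (t/ds) l := rfl
    have h2 := ediv_le (Int.mul c (Int.ofNat S)) D hD
    have e3 : ((Int.mul c (Int.ofNat S) : ℤ):ℝ) = c * S := by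
      have := Int.cast_mul (α := ℝ) c (Int.ofNat S)
      simpa using this
    rw [e3] at h2
    have h3 := mul_le_mul_of_nonneg_left h1 ht
    have hD' : (D:ℝ) ≠ 0 := by exact_mod_cast hD.ne'
    have hds' : (ds:ℝ) ≠ 0 := by exact_mod_cast hds.ne'
    rw [e1, e2]
    have e4 : (S:ℝ) / D * ((c:ℝ) + t/ds * ev1 (t/ds) l) =
      c * S / D + t * ((S:ℝ) / ((D * ds : ℕ):ℝ) * ev1 (t/ds) l) := by
      push_cast; field_simp
    rw [e4]; linarith

theorem dA_le (da ds S : ℕ) (hda : 0 < da) (hds : 0 < ds) (l : P2) : ∀ (D : ℕ), 0 < D →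
    ∀ a t : ℝ, 0 ≤ a → 0 ≤ t →
    ev2 a t (dA da ds S D l) ≤ S / D * ev2 (a / da) (t / ds) l := by
  induction l with
  | nil => intro D hD a t ha ht; simp [dA, ev2, lev]
  | cons c l ih =>
    intro D hD a t ha ht
    have h1 := ih (D * da) (Nat.mul_pos hD hda) a t ha ht
    have e1 : ev2 a t (dA da ds S D (c :: l)) =
      ev1 t (dS ds S D c) + a * ev2 a t (dA da ds S (D*da) l) := rfl
    have e2 : ev2 (a/da) (t/ds) (c :: l) = ev1 (t/ds) c + a/da * ev2 (a/da) (t/ds) l := rfl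
    have h2 := dS_le ds S hds c D hD t ht
    have h3 := mul_le_mul_of_nonneg_left h1 ha
    have hD' : (D:ℝ) ≠ 0 := by exact_mod_cast hD.ne'
    have hds' : (da:ℝ) ≠ 0 := by exact_mod_cast hda.ne'
    rw [e1, e2]
    have e4 : (S:ℝ) / D * (ev1 (t/ds) c + a/da * ev2 (a/da) (t/ds) l) =
      S / D * ev1 (t/ds) c + a * ((S:ℝ) / ((D * da : ℕ):ℝ) * ev2 (a/da) (t/ds) l) := by
      push_cast; field_simp
    rw [e4]; linarith

theorem box_sound (a0 wa s0 ws : ℕ) (M : P2) (h : box a0 wa s0 ws M = true) (a s : ℝ)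
    (ha : (a0:ℝ) / 64 ≤ a) (ha' : a ≤ ((a0:ℝ) + wa) / 64)
    (hs : (s0:ℝ) / 64 ≤ s) (hs' : s ≤ ((s0:ℝ) + ws) / 64) : 0 ≤ ev2 a s M := by
  have h1 := chk_sound _ _ _ _ _ h (a * 1024 - a0 * 16) (s * 65536 - s0 * 1024)
    (by linarith) (by push_cast; linarith) (by linarith) (by push_cast; linarith)
  rw [ev2_sh, ev2_sh1] at h1
  have ha0 : 0 ≤ a := le_trans (by positivity) ha
  have hs0 : 0 ≤ s := le_trans (by positivity) hs
  have h2 := dA_le DA DS SC (by norm_num [DA]) (by norm_num [DS]) M 1 one_pos (a * 1024) (s * 65536)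
    (by linarith) (by linarith)
  have e1 : (((Int.ofNat (a0 * 2^4) : ℤ) : ℝ) + (a * 1024 - a0 * 16)) = a * 1024 := by
    simp
  have e2 : (((Int.ofNat (s0 * 2^10) : ℤ) : ℝ) + (s * 65536 - s0 * 1024)) = s * 65536 := by
    simp
  rw [e1, e2] at h1
  have e3 : a * 1024 / (DA : ℕ) = a := by norm_num [DA]
  have e4 : s * 65536 / (DS : ℕ) = s := by norm_num [DS]
  rw [e3, e4] at h2
  have h3 : 0 ≤ ((SC:ℕ):ℝ) / ((1:ℕ):ℝ) * ev2 a s M := le_trans h1 h2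
  have h4 : (0:ℝ) < ((SC:ℕ):ℝ) / ((1:ℕ):ℝ) := by
    have : 0 < SC := by unfold SC; positivity
    have : (0:ℝ) < (SC:ℕ) := by exact_mod_cast this
    simpa using this
  exact nonneg_of_mul_nonneg_right h3 h4

theorem pos1_sound (y : P1) (h : pos1 y = true) (v : ℝ) (hv : -1 ≤ v) (hv' : v ≤ 1) :
    0 ≤ ev1 v y := by
  have h1 := chk_sound _ _ _ _ _ h 0 ((v + 1) * 1024)
    le_rfl (by simp) (by linarith) (by push_cast; linarith)
  have h2 := dS_le (2^10) (2^100) (by norm_num) (sh1 (-1) y) 1 one_pos ((v+1) * 1024) (by linarith)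
  rw [ev1_sh] at h2
  have e3 : (((-1 : ℤ)):ℝ) + (v+1) * 1024 / ((2^10 : ℕ) : ℝ) = v := by norm_num
  rw [e3] at h2
  have h3 : 0 ≤ ((2^100:ℕ):ℝ) / ((1:ℕ):ℝ) * ev1 v y := by
    refine le_trans h1 (le_trans (le_of_eq ?_) h2)
    simp [ev2, lev]
  have h4 : (0:ℝ) < ((2^100:ℕ):ℝ) / ((1:ℕ):ℝ) := by norm_num
  exact nonneg_of_mul_nonneg_right h3 h4

/-! ### moments -/

noncomputable def sw (v : ℝ) : ℝ := Real.sqrt (1 - v^2)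

theorem sw_cont : Continuous sw := by unfold sw; fun_prop

theorem mom_rec (n : ℕ) : ((n:ℝ) + 4) * ∫ v in (-1:ℝ)..1, sw v * v^(n+2) =
    ((n:ℝ)+1) * ∫ v in (-1:ℝ)..1, sw v * v^n := by
  have hc := sw_cont
  have h : ∫ v in (-1:ℝ)..1, (((n:ℝ)+1) * (sw v * v^n) - ((n:ℝ)+4) * (sw v * v^(n+2))) =
      (1:ℝ)^(n+1) * ((1 - 1^2) * sw 1) - (-1)^(n+1) * ((1 - (-1)^2) * sw (-1)) := by
    refine intervalIntegral.integral_eq_sub_of_hasDerivAt_of_le (f := fun v => v^(n+1) * ((1 - v^2) * sw v))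
      (by norm_num) (by fun_prop) ?_ ?_
    · intro v hv
      have hp : 0 < 1 - v^2 := by nlinarith [hv.1, hv.2]
      have hsq : sw v ^ 2 = 1 - v^2 := Real.sq_sqrt hp.le
      have hs0 : 0 < sw v := Real.sqrt_pos.mpr hp
      have d1 : HasDerivAt (fun v : ℝ => 1 - v^2) (-(2*v)) v := by
        have := (hasDerivAt_pow 2 v).const_sub 1
        simpa using this
      have d2 : HasDerivAt sw (-(2*v) / (2 * sw v)) v := d1.sqrt hp.ne'
      have d3 := (hasDerivAt_pow (n+1) v).mul (d1.mul d2)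
      refine d3.congr_deriv ?_
      simp only [Nat.add_sub_cancel, Pi.mul_apply]
      push_cast
      rw [← hsq]
      field_simp
      have : v^2 = 1 - sw v^2 := by rw [hsq]; ring
      have e1 : v^(n+1) = v^n * v := pow_succ _ _
      have e2 : v^(n+2) = v^n * v^2 := pow_add _ _ _
      rw [e1, e2]
      have e3 : v^n * v * v = v^n * v^2 := by ring
      linear_combination ((n:ℝ) + 1) * v^n * this
    · apply Continuous.intervalIntegrable; fun_prop
  rw [intervalIntegral.integral_sub, intervalIntegral.integral_const_mul,
    intervalIntegral.integral_const_mul] at h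
  · norm_num at h; linarith
  · apply Continuous.intervalIntegrable; fun_prop
  · apply Continuous.intervalIntegrable; fun_prop

theorem mom_zero : ∫ v in (-1:ℝ)..1, sw v * v^0 = Real.pi / 2 := by
  simp only [pow_zero, mul_one, sw]; exact integral_sqrt_one_sub_sq

theorem mom_odd (k : ℕ) : ∫ v in (-1:ℝ)..1, sw v * v^(2*k+1) = 0 := by
  have h := intervalIntegral.integral_comp_neg (a := (-1:ℝ)) (b := 1) (fun v => sw v * v^(2*k+1))
  have e : ∀ v : ℝ, sw (-v) * (-v)^(2*k+1) = - (sw v * v^(2*k+1)) := by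
    intro v; have : sw (-v) = sw v := by simp [sw]
    rw [this, Odd.neg_pow ⟨k, rfl⟩]; ring
  simp only [e, intervalIntegral.integral_neg, neg_neg] at h
  linarith

noncomputable def evq (a s : ℝ) : List (List ℚ) → ℝ := lev (lev (fun x : ℚ => (x:ℝ)) s) a

theorem evq_add (a s : ℝ) (p q : List (List ℚ)) : evq a s (qadd2 p q) = evq a s p + evq a s q :=
  lev_ladd _ _ _ (fun p q => lev_ladd _ _ _ (fun x y => by push_cast; ring) p q) p q

theorem evq_wsc (a s : ℝ) (w : ℚ) (c : P2) : evq a s (wsc w c) = w * ev2 a s c := by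
  unfold evq wsc ev2
  refine lev_map _ _ _ _ _ (fun b => ?_) c
  refine lev_map _ _ _ _ _ (fun x => ?_) b
  simp [ez]

theorem ev3_cont (a s : ℝ) (l : P3) : Continuous (fun v => ev3 a s v l) := by
  induction l with
  | nil => exact continuous_const
  | cons c l ih =>
    have : (fun v => ev3 a s v (c :: l)) = fun v => ev2 a s c + v * ev3 a s v l := rfl
    rw [this]; fun_prop

theorem mom_sound (a s : ℝ) (k : ℕ) (w : ℚ) (l : P3) (c : ℝ)
    (hw : c * ∫ v in (-1:ℝ)..1, sw v * v^(2*k) = Real.pi / 2 * w) :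
    c * ∫ v in (-1:ℝ)..1, sw v * v^(2*k) * ev3 a s v l = Real.pi / 2 * evq a s (mom k w l) := by
  induction k, w, l using mom.induct with
  | case1 k w => simp [mom, evq, ev3, lev]
  | case2 k w d =>
    have e : ∀ v, ev3 a s v [d] = ev2 a s d := by intro v; simp [ev3, lev]
    simp only [e, mom, evq_wsc, intervalIntegral.integral_mul_const]
    linear_combination ev2 a s d * hw
  | case3 k w d d' l ih =>
    have hc := sw_cont
    have hl := ev3_cont a s l
    have e : ∀ v, sw v * v^(2*k) * ev3 a s v (d :: d' :: l) = ev2 a s d * (sw v * v^(2*k)) +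
       (ev2 a s d' * (sw v * v^(2*k+1)) + sw v * v^(2*(k+1)) * ev3 a s v l) := by
      intro v
      have : ev3 a s v (d :: d' :: l) = ev2 a s d + v * (ev2 a s d' + v * ev3 a s v l) := rfl
      rw [this]; ring
    simp only [e, mom, evq_wsc, evq_add]
    rw [intervalIntegral.integral_add, intervalIntegral.integral_add,
      intervalIntegral.integral_const_mul, intervalIntegral.integral_const_mul, mom_odd]
    · have h2 := mom_rec (2*k)
      have h3 := ih (by
        have e4 : 2*(k+1) = 2*k+2 := by ring
        rw [e4]
        push_cast at h2 ⊢
        have h5 : (2*(k:ℝ)+4) ≠ 0 := by positivity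
        field_simp
        field_simp at hw
        have : (2*(k:ℝ)+4) * (c * ∫ v in (-1:ℝ)..1, sw v * v^(2*k+2)) =
          Real.pi / 2 * w * (2 * k + 1) := by
          linear_combination c * h2 + (2*k+1) / 2 * hw
        linear_combination 2 * this)
      linear_combination ev2 a s d * hw + h3
    all_goals (apply Continuous.intervalIntegrable; fun_prop)

theorem lev_le {α β : Type} (e : α → ℝ) (e' : β → ℝ) (x : ℝ) (hx : 0 ≤ x) (g : β → α) (k : ℝ)
    (hg : ∀ b, e (g b) ≤ k * e' b) (q : List β) :
    lev e x (q.map g) ≤ k * lev e' x q := by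
  induction q with
  | nil => simp [lev]
  | cons b q ih =>
    simp only [List.map, lev]
    have := mul_le_mul_of_nonneg_left ih hx
    linarith [hg b]

theorem GZ_le (a s : ℝ) (ha : 0 ≤ a) (hs : 0 ≤ s) (y : P1) :
    ev2 a s (GZ y) ≤ (2^40 / 64^7) * evq a s (mom 0 (1/16) (GI y)) := by
  refine lev_le _ _ _ ha _ _ (fun b => lev_le _ _ _ hs _ _ (fun x => ?_) b) _
  have hD : 0 < x.den * 64^7 := Nat.mul_pos x.pos (by norm_num)
  have h := ediv_le (x.num * 2^40) (x.den * 64^7) hD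
  have e : (Int.ofNat (x.den * 64^7)) = (x.den : ℤ) * 64^7 := by simp
  rw [e] at h
  refine le_trans h (le_of_eq ?_)
  have : (x:ℝ) = x.num / x.den := by exact_mod_cast (Rat.num_div_den x).symm
  rw [this]; push_cast
  ring

/-- the elementary lower bound for the square root -/
theorem sqrt_lb (r y : ℝ) (hr : 0 ≤ r) (hy : 0 ≤ y) :
    r * y * (1 - (r * y^2 - 1)/2 + 3 * (r * y^2 - 1)^2/8 - 5 * (r*y^2-1)^3/16) ≤ Real.sqrt r := by
  obtain ⟨q, hq, rfl⟩ : ∃ q : ℝ, 0 ≤ q ∧ r = q^2 := ⟨Real.sqrt r, Real.sqrt_nonneg r, (Real.sq_sqrt hr).symm⟩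
  rw [Real.sqrt_sq hq]
  have hz : 0 ≤ q * y := mul_nonneg hq hy
  have h : 0 ≤ q * ((1 - q*y)^4 * (16 + 29 * (q*y) + 20 * (q*y)^2 + 5 * (q*y)^3) / 16) := by positivity
  nlinarith [h]

noncomputable def II (a s : ℝ) : ℝ := ∫ v in (-1:ℝ)..1, sw v * Real.sqrt ((v + 2*a)^2 + s)

theorem II_ge_G (a s : ℝ) (ha : 0 ≤ a) (hs : 0 ≤ s) (y : P1) (hy : pos1 y = true) :
    Real.pi / 2 * (ev2 a s (GZ y) / 2^40) ≤ II a s := by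
  have hc := sw_cont
  have h1 := mom_sound a s 0 (1/16) (GI y) (1/16) (by
    have := mom_zero
    simp only [mul_zero]; rw [this]; push_cast; ring)
  have h2 := GZ_le a s ha hs y
  have h3 : (1/16 : ℝ) * ∫ v in (-1:ℝ)..1, sw v * v^(2*0) * ev3 a s v (GI y) ≤ 64^7 * II a s := by
    unfold II
    rw [← intervalIntegral.integral_const_mul, ← intervalIntegral.integral_const_mul]
    have hl := ev3_cont a s (GI y)
    refine intervalIntegral.integral_mono_on (by norm_num) ?_ ?_ ?_
    · apply Continuous.intervalIntegrable; fun_prop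
    · apply Continuous.intervalIntegrable; fun_prop
    · intro v hv
      have hp := pos1_sound y hy v hv.1 hv.2
      rw [ev3_GI]
      have h5 := sqrt_lb ((v+2*a)^2+s) (ev1 v y / 64) (by positivity) (by positivity)
      have h6 := mul_le_mul_of_nonneg_left h5 (Real.sqrt_nonneg (1 - v^2))
      have e : Real.sqrt (1 - v^2) = sw v := rfl
      rw [e] at h6
      simp only [mul_zero, pow_zero, mul_one]
      linarith
  rw [h1] at h3
  have hpi := Real.pi_pos
  have h4 : Real.pi / 2 * ev2 a s (GZ y) ≤ Real.pi / 2 * ((2^40 / 64^7) * evq a s (mom 0 (1/16) (GI y))) :=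
    mul_le_mul_of_nonneg_left h2 (by positivity)
  linarith

theorem II_ge_simple (a s : ℝ) (hs : 0 ≤ s) :
    Real.pi / 2 * Real.sqrt (4*a^2 + s) ≤ II a s := by
  have hc := sw_cont
  rcases eq_or_lt_of_le (show 0 ≤ 4*a^2+s by positivity) with h0 | h0
  · rw [← h0]; simp only [Real.sqrt_zero, mul_zero]
    unfold II
    refine intervalIntegral.integral_nonneg (by norm_num) (fun v _ => ?_)
    exact mul_nonneg (Real.sqrt_nonneg _) (Real.sqrt_nonneg _)
  · set c := Real.sqrt (4*a^2+s) with hcdef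
    have hc0 : 0 < c := Real.sqrt_pos.mpr h0
    have hc2 : c^2 = 4*a^2+s := Real.sq_sqrt h0.le
    have e : ∫ v in (-1:ℝ)..1, (c * (sw v * v^0) + (2*a/c) * (sw v * v^(2*0+1))) = Real.pi/2 * c := by
      rw [intervalIntegral.integral_add, intervalIntegral.integral_const_mul, intervalIntegral.integral_const_mul,
        mom_odd, mom_zero]
      · ring
      all_goals (apply Continuous.intervalIntegrable; fun_prop)
    rw [← e]
    unfold II
    refine intervalIntegral.integral_mono_on (by norm_num) ?_ ?_ ?_
    · apply Continuous.intervalIntegrable; fun_prop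
    · apply Continuous.intervalIntegrable; fun_prop
    · intro v hv
      have h1 : c + 2*a/c * v ≤ Real.sqrt ((v+2*a)^2+s) := by
        apply Real.le_sqrt_of_sq_le
        have : c + 2*a/c * v = (c^2 + 2*a*v)/c := by field_simp
        rw [this, div_pow, div_le_iff₀ (by positivity), hc2]
        nlinarith [mul_nonneg hs (sq_nonneg v)]
      have h6 := mul_le_mul_of_nonneg_left h1 (Real.sqrt_nonneg (1 - v^2))
      have e : Real.sqrt (1 - v^2) = sw v := rfl
      rw [e] at h6
      simp only [mul_zero, pow_zero, mul_one, zero_add, pow_one]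
      linarith

/-! ### key inequality -/

noncomputable def RR (a s : ℝ) : ℝ := (1 - a^2) * (1 + 2*a^2 - s) * (s + a^2)

theorem ev2_Rm (a s : ℝ) : ev2 a s Rm = RR a s := by
  rw [Rm, ev2_mul, ev2_mul]; simp [ev2, ev1, lev, ez, RR]; ring

theorem kN_kD : ((kN:ℕ):ℝ) / ((kD:ℕ):ℝ) ≤ 0.162278 * (Real.pi / 2)^2 := by
  have h := Real.pi_gt_d20
  have h1 : (3.14159265:ℝ)^2 ≤ Real.pi^2 := by
    apply pow_le_pow_left₀ (by norm_num); linarith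
  have h2 : ((kN:ℕ):ℝ) / ((kD:ℕ):ℝ) = 0.162278 * 3.14159265^2 / 4 := by
    norm_num [kN, kD]
  rw [h2, div_pow]; linarith

theorem final_step (a s g : ℝ) (hg : 0 ≤ g) (hI : Real.pi / 2 * g ≤ II a s)
    (h : RR a s ≤ ((kN:ℕ):ℝ) / ((kD:ℕ):ℝ) * g^2) : RR a s ≤ 0.162278 * (II a s)^2 := by
  have h1 := mul_le_mul_of_nonneg_right kN_kD (sq_nonneg g)
  have h2 : (Real.pi / 2 * g)^2 ≤ (II a s)^2 :=
    pow_le_pow_left₀ (mul_nonneg (by positivity) hg) hI 2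
  nlinarith

theorem kD_pos : (0:ℝ) < ((kD:ℕ):ℝ) := by norm_num [kD]

theorem patch (y : P1) (a0 wa : ℕ) (h : full y a0 wa = true) (a s : ℝ)
    (ha : (a0:ℝ) / 64 ≤ a) (ha' : a ≤ ((a0:ℝ) + wa) / 64) (hs : 0 ≤ s) (hs' : s ≤ 39/64) :
    RR a s ≤ 0.162278 * (II a s)^2 := by
  simp only [full, Bool.and_eq_true] at h
  obtain ⟨hy, hG, hK⟩ := h
  have hb1 : ((0:ℕ):ℝ)/64 ≤ s := by simpa using hs
  have hb2 : s ≤ (((0:ℕ):ℝ) + (39:ℕ)) / 64 := by norm_num; linarith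
  have h1 := box_sound _ _ _ _ _ hG a s ha ha' hb1 hb2
  have h2 := box_sound _ _ _ _ _ hK a s ha ha' hb1 hb2
  have ha0 : 0 ≤ a := le_trans (by positivity) ha
  refine final_step a s (ev2 a s (GZ y) / 2^40) (by positivity) (II_ge_G a s ha0 hs y hy) ?_
  simp only [KP, ev2_add, ev2_sc, ev2_mul, ev2_Rm] at h2
  have e1 : ((Int.negOfNat (kD * 2^80) : ℤ):ℝ) = -((kD:ℕ):ℝ) * 2^80 := by
    rw [Int.negOfNat_eq, Int.ofNat_eq_natCast]; push_cast; ring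
  have e2 : ((Int.ofNat kN : ℤ):ℝ) = ((kN:ℕ):ℝ) := by simp
  rw [e1, e2] at h2
  have := kD_pos
  rw [div_mul_eq_mul_div, le_div_iff₀ this]
  nlinarith

theorem simple (a0 wa s0 ws : ℕ) (h : box a0 wa s0 ws SP = true) (a s : ℝ)
    (ha : (a0:ℝ) / 64 ≤ a) (ha' : a ≤ ((a0:ℝ) + wa) / 64)
    (hs : (s0:ℝ) / 64 ≤ s) (hs' : s ≤ ((s0:ℝ) + ws) / 64) :
    RR a s ≤ 0.162278 * (II a s)^2 := by
  have h2 := box_sound _ _ _ _ _ h a s ha ha' hs hs'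
  have hs0 : 0 ≤ s := le_trans (by positivity) hs
  refine final_step a s (Real.sqrt (4*a^2+s)) (Real.sqrt_nonneg _) (II_ge_simple a s hs0) ?_
  rw [Real.sq_sqrt (by positivity)]
  simp only [SP, ev2_add, ev2_sc, ev2_Rm] at h2
  have e1 : ((Int.negOfNat kD : ℤ):ℝ) = -((kD:ℕ):ℝ) := by
    rw [Int.negOfNat_eq, Int.ofNat_eq_natCast]; push_cast; ring
  have e2 : ev2 a s [[0, Int.ofNat kN],[],[Int.ofNat (4*kN)]] = ((kN:ℕ):ℝ) * (4 * a^2 + s) := by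
    simp [ev2, ev1, lev, ez]; ring
  rw [e1, e2] at h2
  have := kD_pos
  rw [div_mul_eq_mul_div, le_div_iff₀ this]
  linarith

set_option maxRecDepth 100000
theorem fD : full yD 25 7 = true := by decide +kernel
theorem fC : full yC 13 12 = true := by decide +kernel
theorem fB : full yB 4 9 = true := by decide +kernel
theorem fA : full yA 0 4 = true := by decide +kernel
theorem s1 : box 0 64 39 153 SP = true := by decide +kernel
theorem s2 : box 32 32 0 192 SP = true := by decide +kernel

theorem key (a s : ℝ) (ha : 0 ≤ a) (ha1 : a ≤ 1) (hs : 0 ≤ s) (hs3 : s ≤ 1 + 2*a^2) :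
    (1 - a^2) * (1 + 2*a^2 - s) * (s + a^2) ≤ 0.162278 * (II a s)^2 := by
  change RR a s ≤ _
  have h3 : s ≤ 3 := by nlinarith
  rcases le_total s (39/64) with h | h
  · rcases le_total a (1/2) with h1 | h1
    · rcases le_total a (25/64) with h2 | h2
      · rcases le_total a (13/64) with h4 | h4
        · rcases le_total a (4/64) with h5 | h5
          · exact patch _ _ _ fA a s (by norm_num; linarith) (by norm_num; linarith) hs h
          · exact patch _ _ _ fB a s (by norm_num; linarith) (by norm_num; linarith) hs h
        · exact patch _ _ _ fC a s (by norm_num; linarith) (by norm_num; linarith) hs h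
      · exact patch _ _ _ fD a s (by norm_num; linarith) (by norm_num; linarith) hs h
    · exact simple _ _ _ _ s2 a s (by norm_num; linarith) (by norm_num; linarith)
        (by norm_num; linarith) (by norm_num; linarith)
  · exact simple _ _ _ _ s1 a s (by norm_num; linarith) (by norm_num; linarith)
        (by norm_num; linarith) (by norm_num; linarith)

/-! ### algebraic conclusion -/

theorem II_zero_pos : 0 < II 0 0 := by
  have hc := sw_cont
  have h2 := mom_rec 0
  have h0 := mom_zero
  have hpi := Real.pi_pos
  have h3 : ∫ v in (-1:ℝ)..1, sw v * v^(0+2) ≤ II 0 0 := by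
    unfold II
    refine intervalIntegral.integral_mono_on (by norm_num) ?_ ?_ ?_
    · apply Continuous.intervalIntegrable; fun_prop
    · apply Continuous.intervalIntegrable; fun_prop
    · intro v hv
      refine mul_le_mul_of_nonneg_left ?_ (Real.sqrt_nonneg _)
      apply Real.le_sqrt_of_sq_le
      have : v^2 ≤ 1 := by nlinarith [hv.1, hv.2]
      have e : (v+2*0)^2+0 - (v^(0+2))^2 = v^2 * (1 - v^2) := by ring
      nlinarith [mul_nonneg (sq_nonneg v) (sub_nonneg.mpr this)]
  rw [h0] at h2
  norm_num at h2 h3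
  linarith

theorem aux_poly (a d : ℝ) (ha : 0 < a) (ha1 : a < 1) (hd : 0 ≤ d) (hdD : d ≤ 2*a - a^2) :
    (1 + 2*a^2 + d) * ((1 - a^2) * a^2) ≤ 1.6 * a^2 + 0.162278 * (d * (1+a^2)^2) := by
  have hD : 0 < 2*a - a^2 := by nlinarith
  have f0 : 0 ≤ 1.6 * a^2 - (1+2*a^2) * ((1-a^2)*a^2) := by
    have : 0 ≤ 1.6 - (1+2*a^2)*(1-a^2) := by nlinarith [sq_nonneg (a^2 - 1/4)]
    nlinarith [mul_nonneg this (sq_nonneg a)]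
  have f1 : 0 ≤ 1.6 * a^2 + 0.162278 * ((2*a-a^2) * (1+a^2)^2) - (1+a)^2 * ((1-a^2)*a^2) := by
    have h1 : (1+a)^3*(1-a) ≤ 27/16 := by nlinarith [mul_nonneg (sq_nonneg (a-1/2)) (by nlinarith : 0 ≤ a^2 + 3*a + 11/4)]
    have h2 : 1 ≤ (1+a^2)^2 := by nlinarith [sq_nonneg a]
    have h3 : 1 ≤ (2-a) * (1+a^2)^2 := by nlinarith
    have h4 : 0 ≤ 1.6 * a + 0.162278 * ((2-a)*(1+a^2)^2) - (1+a)^3*(1-a)*a := by nlinarith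
    nlinarith [mul_nonneg h4 ha.le]
  have h : 0 ≤ (2*a-a^2) * (1.6 * a^2 + 0.162278 * (d * (1+a^2)^2) - (1 + 2*a^2 + d) * ((1 - a^2) * a^2)) := by
    have g0 := mul_nonneg (sub_nonneg.mpr hdD) f0
    have g1 := mul_nonneg hd f1
    nlinarith
  have := nonneg_of_mul_nonneg_right h hD
  linarith

theorem alg (L a p q4 Q : ℝ) (hL : 0 < L) (ha : 0 ≤ a) (hp : 0 ≤ p) (hq : 0 ≤ q4)
    (F1 : ∀ s, 0 ≤ s → (II a s)^2 ≤ Q * (L * ((1-a^2)*(s+a^2)) + (1+2*a^2-s)*p - q4))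
    (F2 : (1+a^2)^2 ≤ Q * p) (F3 : p ≤ L * (1-a^2)) (F4 : q4 ≤ (1+a)^2 * p) :
    q4 ≤ 0.162278 * L * p * Q := by
  have hp0 : 0 < p := by
    rcases hp.eq_or_lt with h | h
    · rw [← h] at F2; nlinarith [sq_nonneg a]
    · exact h
  have ha2 : 0 < 1 - a^2 := by
    by_contra h; push Not at h; nlinarith
  have ha1 : a < 1 := by nlinarith
  obtain ⟨ρ, hρ⟩ : ∃ ρ, q4 = ρ * p := ⟨q4/p, by field_simp⟩
  have hρ0 : 0 ≤ ρ := by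
    by_contra h; push Not at h; nlinarith
  have hρ1 : ρ ≤ (1+a)^2 := by
    rw [hρ] at F4; exact le_of_mul_le_mul_right F4 hp0
  suffices h : ρ ≤ 0.162278 * L * Q by
    rw [hρ]; nlinarith [mul_le_mul_of_nonneg_right h hp]
  rcases le_or_gt ρ (1+2*a^2) with hc | hc
  · have h1 := F1 (1+2*a^2-ρ) (by linarith)
    have h2 := key a (1+2*a^2-ρ) ha ha1.le (by linarith) (by linarith)
    set s := 1+2*a^2-ρ with hs
    have e : ρ = 1+2*a^2-s := by rw [hs]; ring
    have hs0 : 0 ≤ s := by rw [hs]; linarith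
    rw [hρ, e] at h1
    rw [e]
    have h3 : (II a s)^2 ≤ Q * L * ((1-a^2)*(s+a^2)) := by linarith
    have hpos : 0 < s + a^2 := by
      rcases (add_nonneg hs0 (sq_nonneg a)).eq_or_lt with h | h
      · exfalso
        have hs00 : s = 0 := by nlinarith [sq_nonneg a]
        have ha00 : a = 0 := by
          have : a^2 = 0 := by nlinarith
          exact pow_eq_zero_iff (two_ne_zero) |>.mp this
        rw [← h, hs00, ha00] at h3
        have := II_zero_pos
        nlinarith [pow_pos this 2]
      · exact h
    have hpp : 0 < (1-a^2)*(s+a^2) := mul_pos ha2 hpos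
    have h4 : (1 + 2*a^2 - s) * ((1-a^2)*(s+a^2)) ≤ (0.162278 * L * Q) * ((1-a^2)*(s+a^2)) := by
      linarith
    exact le_of_mul_le_mul_right h4 hpp
  · have ha0 : 0 < a := by
      rcases ha.eq_or_lt with h | h
      · rw [← h] at hc hρ1; norm_num at hc hρ1; linarith
      · exact h
    have h1 := F1 0 le_rfl
    have h2 := II_ge_simple a 0 le_rfl
    have e : Real.sqrt (4*a^2+0) = 2*a := by
      rw [show 4*a^2+0 = (2*a)^2 by ring, Real.sqrt_sq (by linarith)]
    rw [e] at h2
    have hpi := Real.pi_gt_d20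
    have hpi2 : 9.8696 ≤ Real.pi^2 := by nlinarith
    have h3 : Real.pi^2 * a^2 ≤ (II a 0)^2 := by
      have : (Real.pi/2*(2*a))^2 ≤ (II a 0)^2 := pow_le_pow_left₀ (by positivity) h2 2
      nlinarith
    have h4 : 9.8696 * a^2 ≤ (II a 0)^2 := by nlinarith [sq_nonneg a]
    rw [hρ] at h1
    have hd : 0 ≤ ρ - 1 - 2*a^2 := by linarith
    have h5 := mul_le_mul_of_nonneg_left F2 hd
    have h6 : 9.8696 * a^2 + (ρ-1-2*a^2)*(1+a^2)^2 ≤ Q * L * ((1-a^2)*a^2) := by linarith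
    have h7 := aux_poly a (ρ-1-2*a^2) ha0 ha1 hd (by nlinarith)
    have hpp : 0 < (1-a^2)*a^2 := by positivity
    have h8 : ρ * ((1-a^2)*a^2) ≤ (0.162278 * L * Q) * ((1-a^2)*a^2) := by
      linarith [sq_nonneg a]
    exact le_of_mul_le_mul_right h8 hpp

/-! ### analysis -/

theorem cs_ineq (L : ℝ) (hL : 0 < L) (w : ℝ → ℝ) (hw : ContDiff ℝ 1 w) (x1 x2 : ℝ)
    (hx1 : x1 ∈ Set.Icc 0 L) (hx2 : x2 ∈ Set.Icc 0 L) (h1 : w x1 = -1) (h2 : w x2 = 1)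
    (φ : ℝ → ℝ) (hφ : Continuous φ) :
    (∫ v in (-1:ℝ)..1, φ v)^2 ≤ (∫ s in (0:ℝ)..L, (deriv w s)^2) * ∫ s in (0:ℝ)..L, (φ (w s))^2 := by
  have hwc : Continuous w := hw.continuous
  have hdc : Continuous (deriv w) := hw.continuous_deriv le_rfl
  have hφw : Continuous (fun s => φ (w s)) := hφ.comp hwc
  have hsub : ∫ s in x1..x2, φ (w s) * deriv w s = ∫ v in (-1:ℝ)..1, φ v := by
    have := intervalIntegral.integral_comp_mul_deriv (a := x1) (b := x2) (f := w) (f' := deriv w) (g := φ)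
      (fun x _ => (hw.differentiable one_ne_zero x).hasDerivAt) hdc.continuousOn hφ
    rw [h1, h2] at this
    exact this
  set A := ∫ v in (-1:ℝ)..1, φ v with hA
  set B := ∫ s in (0:ℝ)..L, (φ (w s))^2 with hB
  set C := ∫ s in (0:ℝ)..L, (deriv w s)^2 with hC
  have hq : ∀ t : ℝ, 0 ≤ B * (t * t) + (-(2*A)) * t + C := by
    intro t
    have hint : Continuous (fun s => t^2 * (φ (w s))^2 + (deriv w s)^2) := by fun_prop
    have e1 : 2 * A * t = ∫ s in x1..x2, 2 * t * (φ (w s) * deriv w s) := by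
      rw [intervalIntegral.integral_const_mul, hsub]; ring
    have e2 : ∫ s in (0:ℝ)..L, (t^2 * (φ (w s))^2 + (deriv w s)^2) = t^2 * B + C := by
      rw [intervalIntegral.integral_add, intervalIntegral.integral_const_mul]
      all_goals (apply Continuous.intervalIntegrable; fun_prop)
    have hsubset : Set.uIoc x1 x2 ⊆ Set.Ioc 0 L := by
      intro x hx
      rw [Set.mem_uIoc] at hx
      rcases hx with hx | hx
      · exact ⟨lt_of_le_of_lt hx1.1 hx.1, le_trans hx.2 hx2.2⟩
      · exact ⟨lt_of_le_of_lt hx2.1 hx.1, le_trans hx.2 hx1.2⟩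
    have hI : MeasureTheory.IntegrableOn (fun s => t^2 * (φ (w s))^2 + (deriv w s)^2) (Set.Ioc 0 L) :=
      (hint.integrableOn_Icc).mono_set Set.Ioc_subset_Icc_self
    have hF : MeasureTheory.IntegrableOn (fun s => ‖2 * t * (φ (w s) * deriv w s)‖) (Set.Ioc 0 L) := by
      have : Continuous (fun s => ‖2 * t * (φ (w s) * deriv w s)‖) := by fun_prop
      exact (this.integrableOn_Icc).mono_set Set.Ioc_subset_Icc_self
    have h3 : 2 * A * t ≤ t^2 * B + C := by
      rw [e1, ← e2, intervalIntegral.integral_of_le hL.le]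
      refine le_trans (le_abs_self _) ?_
      rw [← Real.norm_eq_abs]
      refine le_trans (intervalIntegral.norm_integral_le_integral_norm_uIoc) ?_
      refine le_trans (MeasureTheory.setIntegral_mono_set hF (Filter.Eventually.of_forall fun s => norm_nonneg _)
        (Filter.Eventually.of_forall hsubset)) ?_
      refine MeasureTheory.setIntegral_mono hF hI (fun s => ?_)
      simp only [Real.norm_eq_abs]
      rw [abs_le]
      constructor
      · nlinarith [sq_nonneg (t * φ (w s) + deriv w s)]
      · nlinarith [sq_nonneg (t * φ (w s) - deriv w s)]
    nlinarith
  have := discrim_le_zero hq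
  rw [discrim] at this
  nlinarith

theorem int_abs (a : ℝ) (ha : 0 ≤ a) (ha1 : a ≤ 1) : ∫ v in (-1:ℝ)..1, |v + a| = 1 + a^2 := by
  have hc : Continuous (fun v : ℝ => |v + a|) := by fun_prop
  rw [← intervalIntegral.integral_add_adjacent_intervals (b := -a)
    (hc.intervalIntegrable _ _) (hc.intervalIntegrable _ _)]
  have e1 : ∫ v in (-1:ℝ)..(-a), |v + a| = ∫ v in (-1:ℝ)..(-a), -(v + a) := by
    apply intervalIntegral.integral_congr
    intro v hv
    rw [Set.uIcc_of_le (by linarith)] at hv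
    exact abs_of_nonpos (by linarith [hv.2])
  have e2 : ∫ v in (-a)..1, |v + a| = ∫ v in (-a)..1, (v + a) := by
    apply intervalIntegral.integral_congr
    intro v hv
    rw [Set.uIcc_of_le (by linarith)] at hv
    exact abs_of_nonneg (by linarith [hv.1])
  rw [e1, e2, intervalIntegral.integral_neg, intervalIntegral.integral_add (by simp) (by simp),
    intervalIntegral.integral_add (by simp) (by simp)]
  simp
  ring

theorem core (L : ℝ) (hL : 0 < L) (w : ℝ → ℝ) (hw : ContDiff ℝ 1 w) (x1 x2 : ℝ)
    (hx1 : x1 ∈ Set.Icc 0 L) (hx2 : x2 ∈ Set.Icc 0 L) (h1 : w x1 = -1) (h2 : w x2 = 1)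
    (hr : ∀ s ∈ Set.Icc 0 L, -1 ≤ w s ∧ w s ≤ 1)
    (a : ℝ) (ha : 0 ≤ a) (hm : ∫ s in (0:ℝ)..L, (w s + a) = 0) :
    ∫ s in (0:ℝ)..L, (w s + a)^4 ≤ 0.162278 * L * (∫ s in (0:ℝ)..L, (w s + a)^2) *
      ∫ s in (0:ℝ)..L, (deriv w s)^2 := by
  have hwc : Continuous w := hw.continuous
  have hcs := cs_ineq L hL w hw x1 x2 hx1 hx2 h1 h2
  have hsc := sw_cont
  have ii : ∀ f : ℝ → ℝ, Continuous f → IntervalIntegrable f MeasureTheory.volume 0 L :=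
    fun f hf => hf.intervalIntegrable _ _
  have F3 : ∫ s in (0:ℝ)..L, (w s + a)^2 ≤ L * (1 - a^2) := by
    have hpos : 0 ≤ ∫ s in (0:ℝ)..L, (1 - (w s)^2) :=
      intervalIntegral.integral_nonneg hL.le (fun s hs => by nlinarith [(hr s hs).1, (hr s hs).2])
    have e : ∀ s, 1 - (w s)^2 = ((1 - a^2) + 2*a*(w s + a)) - (w s + a)^2 := fun s => by ring
    simp only [e] at hpos
    rw [intervalIntegral.integral_sub (ii _ (by fun_prop)) (ii _ (by fun_prop)),
      intervalIntegral.integral_add (ii _ (by fun_prop)) (ii _ (by fun_prop)),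
      intervalIntegral.integral_const_mul, hm] at hpos
    simp at hpos
    linarith
  have hp : 0 ≤ ∫ s in (0:ℝ)..L, (w s + a)^2 :=
    intervalIntegral.integral_nonneg hL.le (fun s _ => by positivity)
  have ha1 : a ≤ 1 := by
    by_contra h; push Not at h
    have h0 : 0 ≤ L * (1 - a^2) := le_trans hp F3
    have h3 : 0 ≤ 1 - a^2 := nonneg_of_mul_nonneg_right h0 hL
    nlinarith
  refine alg L a _ _ _ hL ha hp
    (intervalIntegral.integral_nonneg hL.le (fun s _ => by positivity)) ?_ ?_ F3 ?_
  · intro σ hσ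
    have h := hcs (fun v => sw v * Real.sqrt ((v + 2*a)^2 + σ)) (by fun_prop)
    refine le_trans h (le_of_eq ?_)
    congr 1
    have e : ∫ s in (0:ℝ)..L, (sw (w s) * Real.sqrt ((w s + 2*a)^2 + σ))^2 =
        ∫ s in (0:ℝ)..L, ((((1-a^2)*(σ+a^2)) + (2*a+2*a*σ) * (w s + a)) + (1+2*a^2-σ)*(w s + a)^2 -
          (w s + a)^4) := by
      apply intervalIntegral.integral_congr
      intro s hs
      rw [Set.uIcc_of_le hL.le] at hs
      have hb := hr s hs
      have e1 : sw (w s)^2 = 1 - (w s)^2 := Real.sq_sqrt (by nlinarith [hb.1, hb.2])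
      simp only [mul_pow]
      rw [e1, Real.sq_sqrt (by positivity)]
      ring
    rw [e, intervalIntegral.integral_sub (ii _ (by fun_prop)) (ii _ (by fun_prop)),
      intervalIntegral.integral_add (ii _ (by fun_prop)) (ii _ (by fun_prop)),
      intervalIntegral.integral_add (ii _ (by fun_prop)) (ii _ (by fun_prop)),
      intervalIntegral.integral_const_mul, intervalIntegral.integral_const_mul, hm]
    simp
    ring
  · have h := hcs (fun v => |v + a|) (by fun_prop)
    rw [int_abs a ha ha1] at h
    simpa only [sq_abs] using h
  · rw [← intervalIntegral.integral_const_mul]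
    refine intervalIntegral.integral_mono_on hL.le (ii _ (by fun_prop)) (ii _ (by fun_prop)) ?_
    intro s hs
    have hb := hr s hs
    have : (w s + a)^2 ≤ (1+a)^2 := by nlinarith [hb.1, hb.2]
    nlinarith [sq_nonneg (w s + a)]

/-- the inequality when the midrange is nonnegative -/
theorem half (L : ℝ) (hL : 0 < L) (u : ℝ → ℝ) (hu : ContDiff ℝ 1 u) (x1 x2 : ℝ)
    (hx1 : x1 ∈ Set.Icc 0 L) (hx2 : x2 ∈ Set.Icc 0 L)
    (hr : ∀ s ∈ Set.Icc 0 L, u x1 ≤ u s ∧ u s ≤ u x2) (hc : 0 ≤ u x1 + u x2)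
    (hmean : ∫ s in (0:ℝ)..L, u s = 0) :
    ∫ s in (0:ℝ)..L, (u s) ^ 4 ≤
      0.162278 * L * (∫ s in (0:ℝ)..L, (u s) ^ 2) * (∫ s in (0:ℝ)..L, (deriv u s) ^ 2) := by
  rcases (hr x2 hx2).1.eq_or_lt with heq | hlt
  · have hconst : ∀ s ∈ Set.uIcc 0 L, u s = u x1 := by
      intro s hs
      rw [Set.uIcc_of_le hL.le] at hs
      have := hr s hs
      linarith [this.1, this.2]
    have h0 : u x1 = 0 := by
      rw [intervalIntegral.integral_congr (g := fun _ => u x1) hconst] at hmean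
      simp at hmean
      rcases hmean with h | h
      · exact absurd h hL.ne'
      · exact h
    have e4 : ∫ s in (0:ℝ)..L, (u s)^4 = 0 := by
      rw [intervalIntegral.integral_congr (g := fun _ => (0:ℝ)) (fun s hs => by simp [hconst s hs, h0])]
      simp
    have e2 : ∫ s in (0:ℝ)..L, (u s)^2 = 0 := by
      rw [intervalIntegral.integral_congr (g := fun _ => (0:ℝ)) (fun s hs => by simp [hconst s hs, h0])]
      simp
    rw [e4, e2]; simp
  · set h := (u x2 - u x1)/2 with hh
    set c := (u x1 + u x2)/2 with hcd
    have hpos : 0 < h := by rw [hh]; linarith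
    have ec : ∀ s, (u s - c)/h + c/h = u s / h := fun s => by field_simp; ring
    have hd : ∀ s, deriv (fun s => (u s - c)/h) s = deriv u s / h := by
      intro s
      rw [deriv_div_const, deriv_sub_const]
    have key := core L hL (fun s => (u s - c)/h) ((hu.sub contDiff_const).div_const h) x1 x2 hx1 hx2
      (by rw [div_eq_iff hpos.ne', hh, hcd]; ring)
      (by rw [div_eq_iff hpos.ne', hh, hcd]; ring)
      (fun s hs => by
        have := hr s hs
        constructor
        · rw [le_div_iff₀ hpos, hh, hcd]; linarith [this.1]
        · rw [div_le_iff₀ hpos, hh, hcd]; linarith [this.2])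
      (c/h) (div_nonneg (by rw [hcd]; linarith) hpos.le)
      (by simp only [ec]; rw [intervalIntegral.integral_div, hmean, zero_div])
    simp only [ec, hd, div_pow, intervalIntegral.integral_div] at key
    have h4 : 0 < h^4 := by positivity
    have e : 0.162278 * L * ((∫ s in (0:ℝ)..L, (u s) ^ 2)/h^2) * ((∫ s in (0:ℝ)..L, (deriv u s) ^ 2)/h^2)
      = (0.162278 * L * (∫ s in (0:ℝ)..L, (u s) ^ 2) * (∫ s in (0:ℝ)..L, (deriv u s) ^ 2)) / h^4 := by
      field_simp
    rw [e] at key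
    exact (div_le_div_iff_of_pos_right h4).mp key

end IQ

/-- Theorem 2 (sharp interpolation inequality): for `L > 0` and `u : [0,L] → ℝ` of class `C²`
with `u'(0) = u'(L) = 0` and zero mean, one has
`∫ u⁴ ≤ 0.162278 · L · (∫ u²) · (∫ (u')²)`. -/
theorem interpolation_inequality (L : ℝ) (hL : 0 < L) (u : ℝ → ℝ)
    (hu : ContDiff ℝ 2 u)
    (hu0 : deriv u 0 = 0) (huL : deriv u L = 0)
    (hmean : ∫ s in (0:ℝ)..L, u s = 0) :
    ∫ s in (0:ℝ)..L, (u s) ^ 4 ≤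
      0.162278 * L * (∫ s in (0:ℝ)..L, (u s) ^ 2) *
        (∫ s in (0:ℝ)..L, (deriv u s) ^ 2) := by
  have hu1 : ContDiff ℝ 1 u := hu.of_le (by norm_num)
  have hne : (Set.Icc 0 L).Nonempty := ⟨0, le_rfl, hL.le⟩
  obtain ⟨x1, hx1, hm1⟩ := isCompact_Icc.exists_isMinOn hne hu1.continuous.continuousOn
  obtain ⟨x2, hx2, hm2⟩ := isCompact_Icc.exists_isMaxOn hne hu1.continuous.continuousOn
  rcases le_total 0 (u x1 + u x2) with h | h
  · exact IQ.half L hL u hu1 x1 x2 hx1 hx2 (fun s hs => ⟨hm1 hs, hm2 hs⟩) h hmean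
  · have key := IQ.half L hL (fun s => - u s) hu1.neg x2 x1 hx2 hx1
      (fun s hs => ⟨neg_le_neg (hm2 hs), neg_le_neg (hm1 hs)⟩) (by linarith)
      (by rw [intervalIntegral.integral_neg, hmean, neg_zero])
    have e4 : ∀ s, (-u s)^4 = (u s)^4 := fun s => by ring
    have e2 : ∀ s, (-u s)^2 = (u s)^2 := fun s => by ring
    have ed : ∀ s, (deriv (fun s => -u s) s)^2 = (deriv u s)^2 := fun s => by
      have : deriv (fun s => -u s) s = - deriv u s := deriv.fun_neg
      rw [this]; ring
    simp only [e4, e2, ed] at key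
    exact key
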